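/- arXiv:1912.06345 — 2 statements merged into one kernel-verified Lean document; each statement's English description precedes it below -/
import Mathlib

section
/- Let n ≥ 1 be an integer, let p be a prime in 𝒫_n, and let j be an integer with −4n+1 ≤ j ≤ 3n and p | j. Then the p-adic valuation of the rational number A_j(n) is at least 1; equivalently, p divides the integer 10^{−j}·A_j(n). -/
/-- `A j n`: the Laurent coefficient of `(x+5)^{-(j+1)}` of `R_n` at `x = -5`, i.e.
`(1/(3n-j)!) (d/dx)^{3n-j} [(x+5)^{3n+1} R_n(x)]` at `x = -5`, where
`(x+5)^{3n+1} R_n(x) = 5 x^{2n} (x⁴+6x²+25)^{2n} / (5-x)^{3n+1}`. -/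
noncomputable def A (n : ℕ) (j : ℤ) : ℂ :=
  (1 / ((3 * (n : ℤ) - j).toNat.factorial : ℂ)) *
    iteratedDeriv (3 * (n : ℤ) - j).toNat
      (fun x : ℂ =>
        5 * x ^ (2 * n) * (x ^ 4 + 6 * x ^ 2 + 25) ^ (2 * n) / (5 - x) ^ (3 * n + 1))
      (-5)

/-- `inP n p` : `p` belongs to the set `𝒫_n` of primes `p > max(5, √(3n))` with
`1/2 ≤ {n/p} < 2/3`. -/
def inP (n p : ℕ) : Prop :=
  p.Prime ∧ max 5 (Real.sqrt (3 * n)) < (p : ℝ) ∧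
    1 / 2 ≤ Int.fract ((n : ℝ) / p) ∧ Int.fract ((n : ℝ) / p) < 2 / 3

open PowerSeries in
/-- The Taylor series of `f` at `a`, as a formal power series in `x - a`. -/
noncomputable def taylorPowerSeries (f : ℂ → ℂ) (a : ℂ) : ℂ⟦X⟧ :=
  PowerSeries.mk fun k => 1 / (k.factorial : ℂ) * iteratedDeriv k f a

section Taylor

open PowerSeries

theorem taylorPowerSeries_congr {f g : ℂ → ℂ} {a : ℂ} (h : f =ᶠ[nhds a] g) :
    taylorPowerSeries f a = taylorPowerSeries g a := by
  ext k
  simp [taylorPowerSeries, h.iteratedDeriv_eq k]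

theorem taylorPowerSeries_const (c a : ℂ) : taylorPowerSeries (fun _ => c) a = C c := by
  ext k
  rw [taylorPowerSeries, coeff_mk, coeff_C, iteratedDeriv_const]
  split_ifs with h <;> simp [h]

theorem taylorPowerSeries_id (a : ℂ) : taylorPowerSeries (fun x => x) a = X + C a := by
  ext k
  rw [taylorPowerSeries, coeff_mk, map_add, coeff_C, coeff_X, iteratedDeriv_fun_id]
  rcases k with _ | _ | k <;> simp

theorem taylorPowerSeries_add {f g : ℂ → ℂ} {a : ℂ} (hf : ∀ k : ℕ, ContDiffAt ℂ k f a)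
    (hg : ∀ k : ℕ, ContDiffAt ℂ k g a) :
    taylorPowerSeries (fun x => f x + g x) a = taylorPowerSeries f a + taylorPowerSeries g a := by
  ext k
  simp only [taylorPowerSeries, coeff_mk, map_add]
  rw [← mul_add]
  congr 1
  exact iteratedDeriv_add (hf k) (hg k)

theorem taylorPowerSeries_mul {f g : ℂ → ℂ} {a : ℂ} (hf : ∀ k : ℕ, ContDiffAt ℂ k f a)
    (hg : ∀ k : ℕ, ContDiffAt ℂ k g a) :
    taylorPowerSeries (fun x => f x * g x) a = taylorPowerSeries f a * taylorPowerSeries g a := by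
  ext k
  rw [coeff_mul, Finset.Nat.sum_antidiagonal_eq_sum_range_succ_mk]
  simp only [taylorPowerSeries, coeff_mk]
  rw [iteratedDeriv_fun_mul (hf k) (hg k), Finset.mul_sum]
  refine Finset.sum_congr rfl fun i hi => ?_
  rw [Nat.cast_choose ℂ (Nat.lt_succ_iff.mp (Finset.mem_range.mp hi))]
  have := Nat.factorial_ne_zero k
  field_simp

theorem taylorPowerSeries_eval (P : Polynomial ℂ) (a : ℂ) :
    taylorPowerSeries (fun x => P.eval x) a = Polynomial.aeval (X + C a : ℂ⟦X⟧) P := by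
  have smooth (Q : Polynomial ℂ) (k : ℕ) : ContDiffAt ℂ k (fun x => Q.eval x) a := by
    simpa using (Polynomial.contDiff_aeval (R := ℂ) (𝕜 := ℂ) Q k).contDiffAt
  induction P using Polynomial.induction_on with
  | C c => simpa using taylorPowerSeries_const c a
  | add P Q hP hQ =>
    simp only [Polynomial.eval_add, map_add]
    rw [taylorPowerSeries_add (smooth P) (smooth Q), hP, hQ]
  | monomial k c h =>
    simp only [pow_succ, ← mul_assoc, Polynomial.eval_mul_X]
    rw [taylorPowerSeries_mul (g := fun x => x) (smooth _) (fun _ => contDiffAt_id), h,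
      taylorPowerSeries_id, map_mul _ _ Polynomial.X, Polynomial.aeval_X]

end Taylor

section Numerator

/-- Up to a constant, `x (x⁴ + 6x² + 25)` in the variable `y` with `x = -5 + 10y`. -/
noncomputable def numerator (R : Type*) [CommRing R] : Polynomial R :=
  (1 - 2 * .X) * (2 - 14 * (.X * (1 - .X)) + 25 * (.X * (1 - .X)) ^ 2)

theorem numerator_map {R S : Type*} [CommRing R] [CommRing S] (φ : R →+* S) :
    (numerator R).map φ = numerator S := by
  simp [numerator]

theorem eval_numerator_one_sub {R : Type*} [CommRing R] (x : R) :
    (numerator R).eval (1 - x) = -(numerator R).eval x := by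
  simp [numerator]
  ring

theorem natDegree_numerator_le (R : Type*) [CommRing R] : (numerator R).natDegree ≤ 5 := by
  unfold numerator
  compute_degree

end Numerator

open PowerSeries in
/-- The integral power series `G(y)` such that `A n j` is `2 ^ (2n-1) * 10 ^ j` times its
coefficient at `y ^ (3n - j)`. -/
noncomputable def integralSeries (R : Type*) [CommRing R] (n : ℕ) : R⟦X⟧ :=
  (numerator R : R⟦X⟧) ^ (2 * n) * (PowerSeries.mk 1 : R⟦X⟧) ^ (3 * n + 1)

section IntegralSeries

open PowerSeries

theorem integralSeries_map {R S : Type*} [CommRing R] [CommRing S] (φ : R →+* S) (n : ℕ) :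
    PowerSeries.map φ (integralSeries R n) = integralSeries S n := by
  have h : PowerSeries.map φ (mk 1 : R⟦X⟧) = mk 1 := by
    ext; simp
  simp only [integralSeries, map_mul, map_pow, h]
  rw [← Polynomial.polynomial_map_coe, numerator_map]

theorem integralSeries_mul {R : Type*} [CommRing R] (n : ℕ) :
    integralSeries R n * (1 - X) ^ (3 * n + 1) = (numerator R : R⟦X⟧) ^ (2 * n) := by
  rw [integralSeries, mul_assoc, ← mul_pow, mk_one_mul_one_sub_eq_one, one_pow, mul_one]

theorem rescale_taylorPowerSeries {n : ℕ} (hn : 1 ≤ n) :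
    rescale 10 (taylorPowerSeries (fun x : ℂ =>
        5 * x ^ (2 * n) * (x ^ 4 + 6 * x ^ 2 + 25) ^ (2 * n) / (5 - x) ^ (3 * n + 1)) (-5)) =
      C (10 ^ (3 * n) * 2 ^ (2 * n - 1)) * integralSeries ℂ n := by
  set f : ℂ → ℂ := fun x =>
    5 * x ^ (2 * n) * (x ^ 4 + 6 * x ^ 2 + 25) ^ (2 * n) / (5 - x) ^ (3 * n + 1) with hf
  have hf_smooth (k : ℕ) : ContDiffAt ℂ k f (-5) := by
    refine ContDiffAt.div (by fun_prop) (by fun_prop) (pow_ne_zero _ (by norm_num))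
  let N : Polynomial ℂ := 5 * .X ^ (2 * n) * (.X ^ 4 + 6 * .X ^ 2 + 25) ^ (2 * n)
  let D : Polynomial ℂ := (5 - .X) ^ (3 * n + 1)
  have hD_smooth (k : ℕ) : ContDiffAt ℂ k (fun x => D.eval x) (-5) := by
    simpa using (Polynomial.contDiff_aeval (R := ℂ) (𝕜 := ℂ) D k).contDiffAt
  have key : taylorPowerSeries f (-5) * Polynomial.aeval (X + C (-5) : ℂ⟦X⟧) D =
      Polynomial.aeval (X + C (-5) : ℂ⟦X⟧) N := by
    rw [← taylorPowerSeries_eval, ← taylorPowerSeries_eval,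
      ← taylorPowerSeries_mul hf_smooth hD_smooth]
    apply taylorPowerSeries_congr
    have : ∀ᶠ x : ℂ in nhds (-5), x ≠ 5 := isOpen_ne.mem_nhds (by norm_num)
    filter_upwards [this] with x hx
    have hx' : (5 - x) ≠ 0 := sub_ne_zero.mpr hx.symm
    simp only [hf, N, D, Polynomial.eval_pow, Polynomial.eval_mul, Polynomial.eval_add,
      Polynomial.eval_sub, Polynomial.eval_ofNat, Polynomial.eval_X]
    field_simp
  have h5 : (C (-5) : ℂ⟦X⟧) = -5 := by rw [map_neg, map_ofNat]
  have hnum : ((numerator ℂ : Polynomial ℂ) : ℂ⟦X⟧) =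
      (1 - 2 * X) * (2 - 14 * (X * (1 - X)) + 25 * (X * (1 - X)) ^ 2) := by
    have h2 : ((2 : Polynomial ℂ) : ℂ⟦X⟧) = 2 := map_ofNat (Polynomial.coeToPowerSeries.ringHom) 2
    have h14 : ((14 : Polynomial ℂ) : ℂ⟦X⟧) = 14 :=
      map_ofNat (Polynomial.coeToPowerSeries.ringHom) 14
    have h25 : ((25 : Polynomial ℂ) : ℂ⟦X⟧) = 25 :=
      map_ofNat (Polynomial.coeToPowerSeries.ringHom) 25
    simp [numerator, h2, h14, h25]
  have key' := congrArg (rescale (10 : ℂ)) key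
  simp only [N, D, map_mul, map_pow, map_add, map_sub, Polynomial.aeval_X, map_ofNat, rescale_X,
    h5, map_neg] at key'
  have e1 : (5 : ℂ⟦X⟧) - (10 * X + -5) = 10 * (1 - X) := by ring
  have hne : ((5 : ℂ⟦X⟧) - (10 * X + -5)) ^ (3 * n + 1) ≠ 0 := by
    apply pow_ne_zero
    intro h
    have := congrArg constantCoeff h
    rw [e1, map_mul, map_sub, map_one, map_ofNat, constantCoeff_X] at this
    norm_num at this
  refine mul_right_cancel₀ hne (key'.trans ?_)
  have e2 : (10 * X + -5 : ℂ⟦X⟧) = -5 * (1 - 2 * X) := by ring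
  have e3 : (-5 * (1 - 2 * X) : ℂ⟦X⟧) ^ 4 + 6 * (-5 * (1 - 2 * X)) ^ 2 + 25 =
      400 * (2 - 14 * (X * (1 - X)) + 25 * (X * (1 - X)) ^ 2) := by ring
  have e4 : (C (10 ^ (3 * n) * 2 ^ (2 * n - 1)) : ℂ⟦X⟧) * 10 ^ (3 * n + 1) =
      5 * (-5) ^ (2 * n) * 400 ^ (2 * n) := by
    obtain ⟨m, rfl⟩ : ∃ m, n = m + 1 := ⟨n - 1, by omega⟩
    rw [show 2 * (m + 1) - 1 = 2 * m + 1 by omega, Even.neg_pow (by simp)]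
    have h (a b : ℂ⟦X⟧) : (a * b) ^ (3 * (m + 1)) * a ^ (2 * m + 1) * (a * b) ^ (3 * (m + 1) + 1) =
        b * b ^ (2 * (m + 1)) * (a ^ 4 * b ^ 2) ^ (2 * (m + 1)) := by ring
    have h25 := h 2 5
    rw [show (2 : ℂ⟦X⟧) * 5 = 10 by norm_num,
      show (2 : ℂ⟦X⟧) ^ 4 * 5 ^ 2 = 400 by norm_num] at h25
    simpa only [map_mul, map_pow, map_ofNat] using h25
  rw [e1, e2, e3, mul_pow 10 (1 - X), mul_mul_mul_comm, e4, integralSeries_mul, hnum, mul_pow (-5 : ℂ⟦X⟧),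
    mul_pow (400 : ℂ⟦X⟧), mul_pow (1 - 2 * X : ℂ⟦X⟧)]
  ring

end IntegralSeries

open PowerSeries in
theorem PowerSeries.coeff_pow_char {p : ℕ} {R : Type*} [CommRing R] [IsDomain R] [CharP R p] (f : R⟦X⟧)
    {k : ℕ} (hk : ¬ p ∣ k) : coeff k (f ^ p) = 0 := by
  obtain _ | k := k
  · simp at hk
  have h := congrArg (coeff k) (PowerSeries.derivative_pow f p)
  have hzero : ((p : ℕ) : R⟦X⟧) = 0 := by
    rw [← map_natCast (C (R := R)), CharP.cast_eq_zero, map_zero]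
  rw [coeff_derivative, hzero, zero_mul, zero_mul, map_zero] at h
  refine (mul_eq_zero.mp h).resolve_right fun h' => hk ?_
  exact (CharP.cast_eq_zero_iff R p _).mp (by exact_mod_cast h')

section ModP

open Finset

variable {p : ℕ} [Fact p.Prime]

theorem ZMod.sum_eval_eq_neg_coeff (F : Polynomial (ZMod p)) (hF : F.natDegree < 2 * (p - 1)) :
    ∑ x : ZMod p, F.eval x = -F.coeff (p - 1) := by
  have hp := (Fact.out : p.Prime).two_le
  have hsum (i : ℕ) (hi : i ∈ range (2 * (p - 1))) :
      F.coeff i * ∑ x : ZMod p, x ^ i = if i = p - 1 then -F.coeff (p - 1) else 0 := by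
    split_ifs with h
    · subst h
      have h0 : ∀ x : ZMod p, x ^ (p - 1) = 1 - if x = 0 then 1 else 0 := by
        intro x
        split_ifs with hx
        · simp [hx, show p - 1 ≠ 0 by omega]
        · simp [ZMod.pow_card_sub_one_eq_one hx]
      simp [h0]
    · rcases lt_or_gt_of_ne h with h | h
      · rw [FiniteField.sum_pow_lt_card_sub_one _ _ (by rwa [ZMod.card]), mul_zero]
      · have hred : ∀ x : ZMod p, x ^ i = x ^ (i - (p - 1)) := by
          intro x
          obtain ⟨k, rfl⟩ := Nat.exists_eq_add_of_lt h
          rw [show p - 1 + k + 1 - (p - 1) = k + 1 by omega]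
          rcases eq_or_ne x 0 with rfl | hx
          · simp
          · rw [add_assoc, pow_add, ZMod.pow_card_sub_one_eq_one hx, one_mul]
        simp only [hred]
        rw [FiniteField.sum_pow_lt_card_sub_one _ _ (by
          rw [ZMod.card]; have := mem_range.mp hi; omega), mul_zero]
  simp only [Polynomial.eval_eq_sum_range' hF]
  rw [sum_comm]
  simp only [← mul_sum]
  rw [sum_congr rfl hsum, sum_ite_eq', if_pos (mem_range.mpr (by omega))]

theorem ZMod.coeff_eq_zero_of_antisymm (hp : p ≠ 2) (F : Polynomial (ZMod p))
    (hF : F.natDegree < 2 * (p - 1)) (hanti : ∀ x, F.eval (1 - x) = -F.eval x) :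
    F.coeff (p - 1) = 0 := by
  have hsum : ∑ x : ZMod p, F.eval x = -∑ x : ZMod p, F.eval x := by
    rw [← sum_neg_distrib, ← (Equiv.subLeft (1 : ZMod p)).sum_comp]
    exact sum_congr rfl fun x _ => hanti x
  rw [sum_eval_eq_neg_coeff F hF, neg_neg] at hsum
  exact ZMod.neg_eq_self_iff _ |>.mp hsum |>.resolve_right fun h => by
    have := (Fact.out : p.Prime).eq_one_or_self_of_dvd 2 ⟨_, h.symm⟩
    omega

/-- The only exponent congruent to `3r` mod `p` in the degree range of this polynomial is
`3r - p`. -/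
theorem coeff_reduced_eq_zero {r : ℕ} (h1 : p < 2 * r) (h2 : 3 * r < 2 * p) {b : ℕ}
    (hb : b ≡ 3 * r [MOD p]) :
    (numerator (ZMod p) ^ (2 * r - p) * (1 - .X) ^ (2 * p - 1 - 3 * r)).coeff b = 0 := by
  have hp := (Fact.out : p.Prime).two_le
  have hp2 : p ≠ 2 := by omega
  set e := 2 * p - 1 - 3 * r with he
  set P : Polynomial (ZMod p) := numerator (ZMod p) ^ (2 * r - p) * (1 - .X) ^ e with hP
  have hdeg : P.natDegree ≤ 5 * (2 * r - p) + e := by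
    refine Polynomial.natDegree_mul_le.trans (add_le_add ?_ ?_)
    · refine Polynomial.natDegree_pow_le.trans ?_
      rw [mul_comm]
      exact Nat.mul_le_mul_right _ (natDegree_numerator_le _)
    · refine Polynomial.natDegree_pow_le.trans ?_
      have : (1 - .X : Polynomial (ZMod p)).natDegree ≤ 1 := by compute_degree
      nlinarith
  by_cases hbd : P.natDegree < b
  · exact Polynomial.coeff_eq_zero_of_natDegree_lt hbd
  have hb' : b = 3 * r - p := by
    have hmod : b ≡ 3 * r - p [MOD p] := by
      refine Nat.ModEq.add_right_cancel' p ?_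
      rw [Nat.sub_add_cancel (by omega)]
      exact (Nat.add_modEq_right).trans hb
    obtain ⟨k, hk⟩ := (Nat.modEq_iff_dvd).mp hmod
    have hlt : (b : ℤ) < 3 * r := by omega
    rw [Nat.cast_sub (by omega)] at hk
    push_cast at hk
    have hk1 : k < 1 := by
      by_contra! hcon
      nlinarith
    have hk2 : -1 < k := by
      by_contra! hcon
      nlinarith
    have : k = 0 := by omega
    subst this
    omega
  have hF := ZMod.coeff_eq_zero_of_antisymm hp2 (P * .X ^ e) (by
      refine lt_of_le_of_lt (Polynomial.natDegree_mul_le.trans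
        (add_le_add hdeg (Polynomial.natDegree_X_pow_le e))) ?_
      omega) (fun x => by
    have hodd : Odd (2 * r - p) := by
      have := (Fact.out : p.Prime).odd_of_ne_two hp2
      exact Nat.Even.sub_odd (by omega) (by simp) this
    simp only [hP, Polynomial.eval_mul, Polynomial.eval_pow, eval_numerator_one_sub,
      hodd.neg_pow, Polynomial.eval_sub, Polynomial.eval_one, Polynomial.eval_X]
    ring)
  rwa [show p - 1 = b + e by omega, Polynomial.coeff_mul_X_pow] at hF

open PowerSeries in
theorem coeff_integralSeries_eq_zero {n q r N : ℕ} (hn : n = p * q + r) (h1 : p < 2 * r)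
    (h2 : 3 * r < 2 * p) (hN : N ≡ 3 * n [MOD p]) :
    coeff N (integralSeries (ZMod p) n) = 0 := by
  have hdecomp : integralSeries (ZMod p) n =
      ((numerator (ZMod p) : (ZMod p)⟦X⟧) ^ (2 * q + 1) * (PowerSeries.mk 1) ^ (3 * q + 2)) ^ p *
      ((numerator (ZMod p) ^ (2 * r - p) * (1 - .X) ^ (2 * p - 1 - 3 * r) :
        Polynomial (ZMod p)) : (ZMod p)⟦X⟧) := by
    have h3 : (3 * q + 2) * p = 3 * n + 1 + (2 * p - 1 - 3 * r) := by
      rw [hn, add_mul, mul_add, mul_assoc, mul_comm q p]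
      omega
    have h4 : 2 * n = (2 * q + 1) * p + (2 * r - p) := by
      rw [hn, add_mul, mul_add, mul_assoc, mul_comm q p]
      omega
    have hinv := congrArg (· ^ (2 * p - 1 - 3 * r)) (mk_one_mul_one_sub_eq_one (ZMod p))
    simp only [one_pow, mul_pow] at hinv
    rw [integralSeries, mul_pow, ← pow_mul, ← pow_mul, h3, h4, pow_add, pow_add]
    simp only [Polynomial.coe_mul, Polynomial.coe_pow, Polynomial.coe_sub, Polynomial.coe_one,
      Polynomial.coe_X]
    linear_combination (-(numerator (ZMod p) : (ZMod p)⟦X⟧) ^ ((2 * q + 1) * p) *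
      (numerator (ZMod p) : (ZMod p)⟦X⟧) ^ (2 * r - p) * (PowerSeries.mk 1) ^ (3 * n + 1)) * hinv
  rw [hdecomp, coeff_mul]
  refine sum_eq_zero fun ab hab => ?_
  by_cases ha : p ∣ ab.1
  · rw [Polynomial.coeff_coe, coeff_reduced_eq_zero h1 h2, mul_zero]
    have hb : ab.2 ≡ N [MOD p] := by
      rw [← mem_antidiagonal.mp hab]
      simpa using (((Nat.modEq_zero_iff_dvd).mpr ha).add_right ab.2).symm
    refine (hb.trans hN).trans ?_
    rw [hn, mul_add, mul_left_comm]
    simp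
  · rw [PowerSeries.coeff_pow_char _ ha, zero_mul]

end ModP

theorem inP.exists_quotient_remainder {n p : ℕ} (h : inP n p) :
    ∃ q r, n = p * q + r ∧ p < 2 * r ∧ 3 * r < 2 * p := by
  obtain ⟨hp, h5, hl, hu⟩ := h
  have hp0 : (0 : ℝ) < p := by exact_mod_cast hp.pos
  have hp5 : 5 < p := by exact_mod_cast (le_max_left _ _).trans_lt h5
  have hmod : Int.fract ((n : ℝ) / p) = ((n % p : ℕ) : ℝ) / p := by
    exact_mod_cast Int.fract_div_natCast_eq_div_natCast_mod (k := ℝ) (m := n) (n := p)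
  rw [hmod, div_le_div_iff₀ two_pos hp0] at hl
  rw [hmod, div_lt_div_iff₀ hp0 three_pos] at hu
  have hl' : p ≤ n % p * 2 := by exact_mod_cast (one_mul (p : ℝ)) ▸ hl
  have hu' : n % p * 3 < 2 * p := by exact_mod_cast hu
  obtain ⟨k, hk⟩ := hp.odd_of_ne_two (by omega)
  exact ⟨n / p, n % p, (Nat.div_add_mod n p).symm, by omega, by omega⟩

/-- **Lemma 2.** If `p ∈ 𝒫_n` and `p ∣ j` with `-4n + 1 ≤ j ≤ 3n`, then the `p`-adic
valuation of `A_j(n)` is at least 1: `p` divides the integer `10^{-j} A_j(n)`, i.e.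
`A_j(n) = p · m · 10^j` for some integer `m`. -/
theorem prime_divides_A (n : ℕ) (hn : 1 ≤ n) (p : ℕ) (hp : inP n p) (j : ℤ)
    (hj1 : -(4 * (n : ℤ)) + 1 ≤ j) (hj2 : j ≤ 3 * n) (hpj : (p : ℤ) ∣ j) :
    ∃ m : ℤ, A n j = (p : ℂ) * (m : ℂ) * (10 : ℂ) ^ j := by
  obtain ⟨q, r, hnqr, h1, h2⟩ := hp.exists_quotient_remainder
  have := Fact.mk hp.1
  set N := (3 * (n : ℤ) - j).toNat with hN
  have hNj : (N : ℤ) = 3 * n - j := Int.toNat_of_nonneg (by omega)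
  have hNmod : N ≡ 3 * n [MOD p] := by
    refine (Nat.modEq_iff_dvd).mpr ?_
    rw [hNj]
    push_cast
    simpa using hpj
  have hzero := coeff_integralSeries_eq_zero hnqr h1 h2 hNmod
  rw [← integralSeries_map (Int.castRingHom (ZMod p)), PowerSeries.coeff_map] at hzero
  obtain ⟨c, hc⟩ := (ZMod.intCast_zmod_eq_zero_iff_dvd _ p).mp hzero
  have hA : PowerSeries.coeff N (taylorPowerSeries (fun x : ℂ =>
      5 * x ^ (2 * n) * (x ^ 4 + 6 * x ^ 2 + 25) ^ (2 * n) / (5 - x) ^ (3 * n + 1)) (-5)) =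
      A n j := by
    rw [taylorPowerSeries, PowerSeries.coeff_mk, A]
  have key := congrArg (PowerSeries.coeff N) (rescale_taylorPowerSeries hn)
  rw [PowerSeries.coeff_rescale, hA, PowerSeries.coeff_C_mul,
    ← integralSeries_map (Int.castRingHom ℂ), PowerSeries.coeff_map, hc] at key
  have hpow : (10 : ℂ) ^ (3 * n) = 10 ^ N * (10 : ℂ) ^ j := by
    rw [← zpow_natCast, ← zpow_natCast, ← zpow_add₀ (by norm_num)]
    congr 1
    push_cast
    omega
  refine ⟨2 ^ (2 * n - 1) * c, mul_left_cancel₀ (pow_ne_zero N (by norm_num : (10 : ℂ) ≠ 0)) ?_⟩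
  rw [key, hpow]
  simp only [eq_intCast]
  push_cast
  ring
end

section
/- For every integer n ≥ 1, the complex number i·∫ P_n(x) dx, the integral taken along the straight-line segment from −1−2i to −1+2i (equivalently i·∫_{t=−1}^{1} P_n(−1+2it)·2i dt), is a rational number, and 2^{−⌊5n/2⌋}·L_n·( i·∫_{−1−2i}^{−1+2i} P_n(x) dx ) is an integer. -/
open scoped Classical

/-- The rational function `R_n(x) = 5 x^{2n} (x⁴+6x²+25)^{2n} / ((5+x)^{3n+1} (5-x)^{3n+1})`. -/
noncomputable def R (n : ℕ) : ℂ → ℂ := fun x =>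
  5 * x ^ (2 * n) * (x ^ 4 + 6 * x ^ 2 + 25) ^ (2 * n) /
    ((5 + x) ^ (3 * n + 1) * (5 - x) ^ (3 * n + 1))

/-- `Φ_n = ∏_{p ∈ 𝒫_n} p` (note `𝒫_n ⊆ {p : p ≤ 2n}`). -/
noncomputable def Phi (n : ℕ) : ℕ :=
  ∏ p ∈ (Finset.range (2 * n + 1)).filter (fun p => inP n p), p

/-- `lcm(1, 2, …, m)`. -/
def lcmUpTo (m : ℕ) : ℕ := (Finset.Icc 1 m).lcm id

/-- `L_n = lcm(1,2,…,4n) / Φ_n`. -/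
noncomputable def L (n : ℕ) : ℕ := lcmUpTo (4 * n) / Phi n

/-- The polynomial part `P_n` of the partial-fraction decomposition of `R_n`:
`P_n(x) = R_n(x) - Σ_{j=0}^{3n} (A_j/(5+x)^{j+1} + A_j/(5-x)^{j+1})`. -/
noncomputable def Ppart (n : ℕ) : ℂ → ℂ := fun x =>
  R n x - ∑ j ∈ Finset.range (3 * n + 1),
    (A n j / (5 + x) ^ (j + 1) + A n j / (5 - x) ^ (j + 1))

section PartialFractions

open Polynomial

lemma iteratedDeriv_polynomial_eval (p : ℂ[X]) (k : ℕ) :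
    iteratedDeriv k (fun x => p.eval x) = fun x => (derivative^[k] p).eval x := by
  induction k with
  | zero => simp
  | succ k ih =>
    rw [iteratedDeriv_succ, ih]
    funext x
    rw [Polynomial.deriv, Function.iterate_succ_apply']

lemma contDiff_polynomial_eval (p : ℂ[X]) (k : ℕ) : ContDiff ℂ k (fun x => p.eval x) := by
  simpa using p.contDiff_aeval (𝕜 := ℂ) (n := k)

/-- If `T` has the Taylor coefficients of `N / B` at `r` up to order `a`, then `N - T(X - r) B`
vanishes to order `a` at `r`. -/
lemma X_sub_C_pow_dvd_of_taylor (N B T : ℂ[X]) (r : ℂ) (a : ℕ) (hB : B.eval r ≠ 0)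
    (hT : ∀ k < a, (k.factorial : ℂ) * T.coeff k =
      iteratedDeriv k (fun x => N.eval x / B.eval x) r) :
    (X - C r) ^ a ∣ N - T.comp (X - C r) * B := by
  set G := N - T.comp (X - C r) * B with hG
  by_cases hG0 : G = 0
  · rw [hG0]; exact dvd_zero _
  rw [← le_rootMultiplicity_iff hG0]
  rcases a with _ | a
  · simp
  refine (lt_rootMultiplicity_iff_isRoot_iterate_derivative hG0).2 fun m hm => ?_
  have hquot : ∀ k : ℕ, ContDiffAt ℂ k (fun x => N.eval x / B.eval x) r := fun k =>
    (contDiff_polynomial_eval N k).contDiffAt.div (contDiff_polynomial_eval B k).contDiffAt hB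
  have hvan : ∀ k < a + 1, iteratedDeriv k
      (fun x => N.eval x / B.eval x - (T.comp (X - C r)).eval x) r = 0 := by
    intro k hk
    rw [iteratedDeriv_fun_sub (hquot k) (contDiff_polynomial_eval _ k).contDiffAt, ← hT k hk]
    have h1 : (fun x => (T.comp (X - C r)).eval x) = fun x => (fun y => T.eval y) (x + -r) := by
      funext x; simp [sub_eq_add_neg]
    rw [h1, congrFun (iteratedDeriv_comp_add_const k (fun y => T.eval y) (-r)) r,
      iteratedDeriv_polynomial_eval]
    simp only [add_neg_cancel]
    rw [← coeff_zero_eq_eval_zero, coeff_iterate_derivative]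
    simp [Nat.descFactorial_self]
  have hev : (fun x => G.eval x) =ᶠ[nhds r]
      fun x => B.eval x * (N.eval x / B.eval x - (T.comp (X - C r)).eval x) := by
    have : ∀ᶠ x in nhds r, B.eval x ≠ 0 :=
      B.continuous.continuousAt.eventually_ne hB
    filter_upwards [this] with x hx
    rw [hG]
    simp only [eval_sub, eval_mul]
    field_simp
  have h := hev.iteratedDeriv_eq m
  rw [iteratedDeriv_polynomial_eval, iteratedDeriv_fun_mul
    (contDiff_polynomial_eval B m).contDiffAt
    ((hquot m).sub (contDiff_polynomial_eval _ m).contDiffAt)] at h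
  refine h.trans ?_
  refine Finset.sum_eq_zero fun i _ => ?_
  rw [hvan (m - i) (by omega), mul_zero]

/-- The numerator of `R n` as an integral polynomial. -/
noncomputable def numer (n : ℕ) : ℤ[X] :=
  5 * X ^ (2 * n) * (X ^ 4 + 6 * X ^ 2 + 25) ^ (2 * n)

/-- The polynomial part of `R n` as an integral polynomial. -/
noncomputable def polyPart (n : ℕ) : ℤ[X] :=
  C ((-1) ^ (3 * n + 1)) * (numer n /ₘ (X ^ 2 - C 25) ^ (3 * n + 1))

/-- The polynomial carrying the coefficients of the principal part of `R n` at `-5`. -/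
noncomputable def principal (n : ℕ) : ℂ[X] :=
  ∑ j ∈ Finset.range (3 * n + 1), C (A n j) * X ^ (3 * n - j)

lemma principal_coeff (n k : ℕ) :
    (principal n).coeff k = if k < 3 * n + 1 then A n ((3 * n - k : ℕ) : ℤ) else 0 := by
  rw [principal, ← Finset.sum_range_reflect]
  simp only [finsetSum_coeff, coeff_C_mul, coeff_X_pow]
  split_ifs with h
  · rw [Finset.sum_eq_single k]
    · have : 3 * n - (3 * n + 1 - 1 - k) = k := by omega
      simp only [this, if_true, mul_one]
      congr 2
    · intro b hb hbk
      rw [Finset.mem_range] at hb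
      rw [if_neg (by omega), mul_zero]
    · intro hk; exact absurd (Finset.mem_range.2 h) hk
  · refine Finset.sum_eq_zero fun b hb => ?_
    rw [Finset.mem_range] at hb
    rw [if_neg (by omega), mul_zero]

lemma principal_degree_lt (n : ℕ) : (principal n).degree < (3 * n + 1 : ℕ) := by
  rw [degree_lt_iff_coeff_zero]
  intro m hm
  rw [principal_coeff, if_neg (by omega)]

lemma eval_map_numer (n : ℕ) (x : ℂ) : ((numer n).map (Int.castRingHom ℂ)).eval x =
    5 * x ^ (2 * n) * (x ^ 4 + 6 * x ^ 2 + 25) ^ (2 * n) := by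
  simp [numer]

lemma factorial_mul_principal_coeff (n k : ℕ) (hk : k < 3 * n + 1) :
    (k.factorial : ℂ) * (principal n).coeff k = iteratedDeriv k
      (fun x => ((numer n).map (Int.castRingHom ℂ)).eval x /
        ((5 - X : ℂ[X]) ^ (3 * n + 1)).eval x) (-5) := by
  have h : (3 * (n : ℤ) - ((3 * n - k : ℕ) : ℤ)).toNat = k := by omega
  rw [principal_coeff, if_pos hk, A, h]
  have : (k.factorial : ℂ) ≠ 0 := by exact_mod_cast k.factorial_ne_zero
  rw [← mul_assoc, mul_one_div_cancel this, one_mul]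
  congr 1
  funext x
  rw [eval_map_numer]
  simp

lemma monic_X_sq_sub (S : Type*) [CommRing S] (c : S) (a : ℕ) :
    ((X ^ 2 - C c : S[X]) ^ a).Monic :=
  (monic_X_pow_sub_C c two_ne_zero).pow a

lemma numer_partialFraction (n : ℕ) :
    (numer n).map (Int.castRingHom ℂ) =
      ((5 + X) * (5 - X)) ^ (3 * n + 1) * (polyPart n).map (Int.castRingHom ℂ) +
      (principal n).comp (5 + X) * (5 - X) ^ (3 * n + 1) +
      (principal n).comp (5 - X) * (5 + X) ^ (3 * n + 1) := by
  set N := (numer n).map (Int.castRingHom ℂ) with hN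
  set T := principal n
  set a := 3 * n + 1
  set F := N - T.comp (5 + X) * (5 - X) ^ a - T.comp (5 - X) * (5 + X) ^ a with hF
  have hNe : N.comp (-X) = N := by
    simp [hN, numer, (even_two_mul n).neg_pow, (by decide : Even 4).neg_pow]
  have hc : (X - C (-5) : ℂ[X]) = 5 + X := by
    rw [C_neg, sub_neg_eq_add, add_comm]; rfl
  have h1 : (5 + X : ℂ[X]) ^ a ∣ F := by
    have h := X_sub_C_pow_dvd_of_taylor N ((5 - X) ^ a) T (-5) a
      (by simp) (fun k hk => factorial_mul_principal_coeff n k hk)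
    rw [hc] at h
    exact dvd_sub h (dvd_mul_left _ _)
  have hFe : F.comp (-X) = F := by
    simp only [hF, sub_comp, mul_comp, comp_assoc, pow_comp, hNe, add_comp, ofNat_comp, X_comp,
      Nat.cast_ofNat]
    rw [← sub_eq_add_neg, sub_neg_eq_add]
    ring
  have h2 : (5 - X : ℂ[X]) ^ a ∣ F := by
    obtain ⟨g, hg⟩ := h1
    rw [← hFe, hg]
    refine ⟨g.comp (-X), ?_⟩
    simp [sub_eq_add_neg]
  have hcop : IsCoprime (5 + X : ℂ[X]) (5 - X) := by
    refine ⟨C (1 / 10), C (1 / 10), ?_⟩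
    rw [← mul_add]
    have : (5 + X + (5 - X) : ℂ[X]) = C 10 := by
      have h10 : (C 10 : ℂ[X]) = 10 := rfl
      rw [h10]; ring
    rw [this, ← C_mul]; norm_num
  obtain ⟨P, hP⟩ := (hcop.pow (m := a) (n := a)).mul_dvd h1 h2
  have hD : ((5 + X) ^ a * (5 - X) ^ a : ℂ[X]) = C ((-1) ^ a) * (X ^ 2 - C 25) ^ a := by
    rw [← mul_pow, C_pow, ← mul_pow]
    congr 1
    have h25 : (C 25 : ℂ[X]) = 25 := rfl
    rw [h25, C_neg, C_1]; ring
  have hs : ∀ q : ℂ[X], q.natDegree ≤ 1 → (T.comp q).degree < (a : ℕ) := by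
    intro q hq
    by_cases h0 : T.comp q = 0
    · rw [h0, degree_zero]; exact WithBot.bot_lt_coe _
    rw [← natDegree_lt_iff_degree_lt h0]
    have hT : T.natDegree < a := by
      rw [natDegree_lt_iff_degree_lt]
      · exact principal_degree_lt n
      · rintro h; exact h0 (by rw [h, zero_comp])
    calc _ ≤ T.natDegree * q.natDegree := natDegree_comp_le
      _ ≤ T.natDegree * 1 := Nat.mul_le_mul_left _ hq
      _ < a := by omega
  have hp5 : (5 + X : ℂ[X]) = X + C 5 := by rw [add_comm]; rfl
  have hm5 : (5 - X : ℂ[X]) = -(X - C 5) := by rw [neg_sub]; rfl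
  have hdp : (5 + X : ℂ[X]).degree = 1 := by rw [hp5]; exact degree_X_add_C _
  have hdm : (5 - X : ℂ[X]).degree = 1 := by rw [hm5, degree_neg]; exact degree_X_sub_C _
  have hlt : ∀ q r : ℂ[X], q.degree = 1 → r.degree = 1 →
      (T.comp q * r ^ a).degree < ((X ^ 2 - C 25 : ℂ[X]) ^ a).degree := by
    intro q r hq hr
    rw [degree_mul, degree_pow, hr, degree_pow, degree_X_pow_sub_C two_pos]
    have h3 := hs q (natDegree_le_of_degree_le (by rw [hq]; rfl))
    calc (T.comp q).degree + a • (1 : WithBot ℕ) = (T.comp q).degree + (a : ℕ) := by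
          simp
      _ < (a : ℕ) + (a : ℕ) := WithBot.add_lt_add_right (by simp) h3
      _ = _ := by simp [mul_two]
  have hdiv := (div_modByMonic_unique (f := N) (g := (X ^ 2 - C 25) ^ a) (C ((-1) ^ a) * P)
    (T.comp (5 + X) * (5 - X) ^ a + T.comp (5 - X) * (5 + X) ^ a)
    (monic_X_sq_sub ℂ 25 a) ⟨by
      have : (X ^ 2 - C 25) ^ a * (C ((-1) ^ a) * P) = F := by
        rw [hP, hD]; ring
      rw [this, hF]; ring,
      (degree_add_le _ _).trans_lt (max_lt (hlt _ _ hdp hdm) (hlt _ _ hdm hdp))⟩).1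
  have hPP : (polyPart n).map (Int.castRingHom ℂ) = P := by
    rw [polyPart, Polynomial.map_mul, map_divByMonic _ (monic_X_sq_sub ℤ 25 _)]
    have : ((X ^ 2 - C 25 : ℤ[X]) ^ (3 * n + 1)).map (Int.castRingHom ℂ) =
        (X ^ 2 - C 25) ^ a := by simp [a]; rfl
    rw [this, ← hN, hdiv, map_C, ← mul_assoc, ← C_mul]
    have : (Int.castRingHom ℂ) ((-1) ^ (3 * n + 1)) * (-1) ^ a = 1 := by
      simp only [map_pow, map_neg, map_one, a]
      rw [← mul_pow]; simp
    rw [this, C_1, one_mul]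
  rw [hPP, mul_pow, ← hP, hF]
  ring

lemma Ppart_eq_eval (n : ℕ) (x : ℂ) (h1 : 5 + x ≠ 0) (h2 : 5 - x ≠ 0) :
    Ppart n x = ((polyPart n).map (Int.castRingHom ℂ)).eval x := by
  have hsum : ∀ u : ℂ, u ≠ 0 → ∑ j ∈ Finset.range (3 * n + 1), A n j / u ^ (j + 1) =
      (principal n).eval u / u ^ (3 * n + 1) := by
    intro u hu
    rw [principal, eval_finsetSum, Finset.sum_div]
    refine Finset.sum_congr rfl fun j hj => ?_
    rw [Finset.mem_range] at hj
    have : u ^ (3 * n + 1) = u ^ (3 * n - j) * u ^ (j + 1) := by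
      rw [← pow_add]; congr 1; omega
    rw [this]
    simp only [eval_mul, eval_C, eval_pow, eval_X]
    field_simp
  have h := congrArg (eval x) (numer_partialFraction n)
  rw [eval_map_numer] at h
  simp only [eval_add, eval_mul, eval_pow, eval_comp, eval_sub, eval_ofNat, eval_X] at h
  rw [Ppart, R, h, Finset.sum_add_distrib, hsum _ h1, hsum _ h2, mul_pow]
  field_simp
  ring

end PartialFractions

section ModPrime

open Polynomial

/-- Exact division by a polynomial in `X ^ p` preserves the vanishing of the coefficients whose
index is `-1` modulo `p`. -/
lemma contract_X_mul_eq_zero {K : Type*} [Field K] {p : ℕ} (hp : 0 < p) (Q M S : K[X])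
    (hM : M.Monic) (hS : S.degree < (expand K p M).degree)
    (h : contract p (X * (Q * expand K p M + S)) = 0) :
    contract p (X * Q) = 0 := by
  by_contra hU
  have h1 : contract p (X * Q) * M = - contract p (X * S) := by
    rw [mul_add, contract_add hp.ne', ← mul_assoc, contract_mul_expand hp.ne'] at h
    exact eq_neg_of_add_eq_zero_left h
  have h2 : (contract p (X * S)).natDegree ≤ M.natDegree := by
    rw [natDegree_le_iff_coeff_eq_zero]
    intro k hk
    rw [coeff_contract hp.ne']
    obtain ⟨l, hl⟩ : ∃ l, k * p = l + 1 := ⟨k * p - 1, by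
      have : 0 < k * p := Nat.mul_pos (by omega) hp
      omega⟩
    rw [hl, coeff_X_mul]
    refine coeff_eq_zero_of_degree_lt (hS.trans_le ?_)
    refine degree_le_of_natDegree_le ?_
    rw [natDegree_expand]
    have : M.natDegree * p < k * p := Nat.mul_lt_mul_of_pos_right hk hp
    omega
  have h3 := congrArg natDegree h1
  rw [natDegree_neg, mul_comm, hM.natDegree_mul' hU] at h3
  have h4 : (contract p (X * Q)).natDegree = 0 := by omega
  rw [natDegree_eq_zero] at h4
  obtain ⟨c, hc⟩ := h4
  have h5 : (contract p (X * Q)).coeff 0 = 0 := by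
    rw [coeff_contract hp.ne', zero_mul, mul_coeff_zero, coeff_X_zero, zero_mul]
  rw [← hc, coeff_C_zero] at h5
  exact hU (by rw [← hc, h5, C_0])

lemma inP.prime {n p : ℕ} (h : inP n p) : p.Prime := h.1

lemma inP.five_lt {n p : ℕ} (h : inP n p) : 5 < p := by
  have := (le_max_left _ _).trans_lt h.2.1
  exact_mod_cast this

lemma inP.odd {n p : ℕ} (h : inP n p) : Odd p :=
  h.prime.odd_of_ne_two (by have := h.five_lt; omega)

lemma inP.mod_bounds {n p : ℕ} (h : inP n p) : p ≤ 2 * (n % p) ∧ 3 * (n % p) < 2 * p := by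
  have hp : (0 : ℝ) < p := by exact_mod_cast h.prime.pos
  obtain ⟨-, -, h1, h2⟩ := h
  rw [Int.fract_div_natCast_eq_div_natCast_mod] at h1 h2
  rw [div_le_div_iff₀ two_pos hp] at h1
  rw [div_lt_div_iff₀ hp three_pos] at h2
  constructor
  · have : (p : ℝ) ≤ (2 * (n % p) : ℕ) := by push_cast at *; linarith
    exact_mod_cast this
  · have : ((3 * (n % p) : ℕ) : ℝ) < (2 * p : ℕ) := by push_cast at *; linarith
    exact_mod_cast this

lemma dvd_polyPart_coeff {n p m : ℕ} (h : inP n p) (hm : p ∣ m + 1) :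
    (p : ℤ) ∣ (polyPart n).coeff m := by
  have hb := h.mod_bounds
  have hpp := h.prime.pos
  have : Fact p.Prime := ⟨h.prime⟩
  set r := n % p with hr
  set q := n / p with hq
  have hn : n = p * q + r := (Nat.div_add_mod n p).symm
  obtain ⟨s, hs⟩ : ∃ s, 2 * r = p + s := ⟨2 * r - p, by omega⟩
  obtain ⟨e, he⟩ : ∃ e, 3 * r + 1 + e = 2 * p := ⟨2 * p - 1 - 3 * r, by omega⟩
  have hsodd : Odd s := by
    obtain ⟨k, hk⟩ := h.odd
    exact ⟨r - k - 1, by omega⟩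
  have h2n : 2 * n = (2 * q + 1) * p + s := by rw [hn]; linarith
  have h3n : 3 * n + 1 + e = (3 * q + 2) * p := by rw [hn]; linarith
  set K := ZMod p
  set M : K[X] := X ^ 4 + 6 * X ^ 2 + 25 with hMdef
  set B : K[X] := X ^ 2 - C 25 with hBdef
  set w : K[X] := 5 * X ^ s * M ^ s * B ^ e with hw
  have hBm : B.Monic := monic_X_pow_sub_C 25 two_ne_zero
  have hBdeg : B.natDegree = 2 := natDegree_X_pow_sub_C
  have hMdeg : M.natDegree ≤ 4 := by rw [hMdef]; compute_degree
  set N : K[X] := (numer n).map (Int.castRingHom K) with hN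
  have hNval : N = 5 * X ^ (2 * n) * M ^ (2 * n) := by simp [hN, numer, hMdef]
  have hNE : N * B ^ e = w * expand K p (X ^ (2 * q + 1) * M ^ (2 * q + 1)) := by
    rw [ZMod.expand_card, mul_pow, ← pow_mul, ← pow_mul, hNval, h2n, hw, pow_add, pow_add]
    ring
  have hDE : B ^ (3 * n + 1) * B ^ e = expand K p (B ^ (3 * q + 2)) := by
    rw [ZMod.expand_card, ← pow_mul, ← pow_add, h3n]
  have hwdeg : w.natDegree < 2 * p - 1 := by
    have h5 : (5 : K[X]).natDegree = 0 := natDegree_ofNat 5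
    calc w.natDegree ≤ 0 + s + s * 4 + e * 2 := by
          refine natDegree_mul_le_of_le (natDegree_mul_le_of_le (natDegree_mul_le_of_le h5.le
            (natDegree_X_pow_le s)) (natDegree_pow_le_of_le s hMdeg))
            (natDegree_pow_le_of_le e hBdeg.le)
      _ < _ := by omega
  have hwodd : w.comp (-X) = -w := by
    have h1 : M.comp (-X) = M := by simp [hMdef, (by decide : Even 4).neg_pow]
    have h2 : B.comp (-X) = B := by simp [hBdef]
    simp only [hw, mul_comp, pow_comp, h1, h2, X_comp, ofNat_comp, hsodd.neg_pow]
    ring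
  have hwc : w.coeff (p - 1) = 0 := by
    have h1 := congrArg (fun f => coeff f (p - 1)) hwodd
    have h2 : (-X : K[X]) = C (-1) * X := by simp
    have h3 : Even (p - 1) := by
      obtain ⟨k, hk⟩ := h.odd
      exact ⟨k, by omega⟩
    simp only [h2, comp_C_mul_X_coeff, h3.neg_one_pow, mul_one, coeff_neg] at h1
    have h4 : (2 : K) * w.coeff (p - 1) = 0 := by linear_combination h1
    rcases mul_eq_zero.1 h4 with h5 | h5
    · exfalso
      have h6 : ((2 : ℕ) : ZMod p) = 0 := by exact_mod_cast h5
      rw [ZMod.natCast_eq_zero_iff] at h6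
      have := Nat.le_of_dvd two_pos h6
      have := h.five_lt
      omega
    · exact h5
  have hcw : contract p (X * w) = 0 := by
    ext k
    rw [coeff_contract hpp.ne', coeff_zero]
    rcases k with _ | _ | k
    · simp
    · have : (0 + 1) * p = (p - 1) + 1 := by omega
      rw [this, coeff_X_mul, hwc]
    · have : (k + 1 + 1) * p = (k * p + 2 * p - 1) + 1 := by
        have : (k + 1 + 1) * p = k * p + 2 * p := by ring
        omega
      rw [this, coeff_X_mul]
      exact coeff_eq_zero_of_natDegree_lt (by omega)
  have hdm := modByMonic_add_div N (B ^ (3 * n + 1))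
  have hmain : contract p (X * (N /ₘ B ^ (3 * n + 1))) = 0 := by
    refine contract_X_mul_eq_zero hpp _ (B ^ (3 * q + 2)) ((N %ₘ B ^ (3 * n + 1)) * B ^ e)
      (hBm.pow _) ?_ ?_
    · rw [← hDE, degree_mul, degree_mul]
      refine WithBot.add_lt_add_right ?_ (degree_modByMonic_lt N (hBm.pow (3 * n + 1)))
      rw [degree_ne_bot]
      exact (hBm.pow e).ne_zero
    · rw [← hDE]
      have : (N /ₘ B ^ (3 * n + 1)) * (B ^ (3 * n + 1) * B ^ e) +
          (N %ₘ B ^ (3 * n + 1)) * B ^ e = N * B ^ e := by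
        conv_rhs => rw [← hdm]
        ring
      rw [this, hNE, ← mul_assoc, contract_mul_expand hpp.ne', hcw, zero_mul]
  rw [← ZMod.intCast_zmod_eq_zero_iff_dvd, polyPart, coeff_C_mul, Int.cast_mul]
  have hcoeff : (((numer n /ₘ (X ^ 2 - C 25) ^ (3 * n + 1)).coeff m : ℤ) : ZMod p) =
      (N /ₘ B ^ (3 * n + 1)).coeff m := by
    have h1 := map_divByMonic (p := numer n) (Int.castRingHom K) (monic_X_sq_sub ℤ 25 (3 * n + 1))
    have h2 : ((X ^ 2 - C 25 : ℤ[X]) ^ (3 * n + 1)).map (Int.castRingHom K) =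
        B ^ (3 * n + 1) := by simp [hBdef]; rfl
    rw [h2, ← hN] at h1
    rw [← h1, coeff_map]
    rfl
  obtain ⟨k, hk⟩ := hm
  have h1 := congrArg (fun f => coeff f k) hmain
  simp only [coeff_contract hpp.ne', coeff_zero] at h1
  rw [mul_comm k p, ← hk, coeff_X_mul] at h1
  rw [hcoeff, h1, mul_zero]

end ModPrime

section TwoAdic

open Polynomial

/-- The localization of the Gaussian integers at the odd rational integers, inside `ℂ`. -/
def oddLocalization : Subring ℂ where
  carrier := {z | ∃ c a b : ℤ, Odd c ∧ (c : ℂ) * z = a + b * Complex.I}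
  mul_mem' := by
    rintro x y ⟨c, a, b, hc, h⟩ ⟨c', a', b', hc', h'⟩
    refine ⟨c * c', a * a' - b * b', a * b' + b * a', hc.mul hc', ?_⟩
    push_cast
    have hI := Complex.I_sq
    linear_combination (c' * y) * h + (a + b * Complex.I) * h' + (b * b') * hI
  one_mem' := ⟨1, 1, 0, odd_one, by simp⟩
  add_mem' := by
    rintro x y ⟨c, a, b, hc, h⟩ ⟨c', a', b', hc', h'⟩
    refine ⟨c * c', c' * a + c * a', c' * b + c * b', hc.mul hc', ?_⟩
    push_cast
    linear_combination c' * h + c * h'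
  zero_mem' := ⟨1, 0, 0, odd_one, by simp⟩
  neg_mem' := by
    rintro x ⟨c, a, b, hc, h⟩
    refine ⟨c, -a, -b, hc, ?_⟩
    push_cast
    linear_combination -h

lemma I_mem_oddLocalization : Complex.I ∈ oddLocalization :=
  ⟨1, 0, 1, odd_one, by simp⟩

lemma inv_mem_oddLocalization {c : ℤ} (hc : Odd c) : (c : ℂ)⁻¹ ∈ oddLocalization := by
  have : (c : ℂ) ≠ 0 := by
    rintro h
    rw [Int.cast_eq_zero] at h
    simp [h] at hc
  exact ⟨c, 1, 0, hc, by simp [this]⟩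

lemma two_pow_dvd_of_eq_mul {M : ℤ} {f : ℕ} {z : ℂ} (hz : z ∈ oddLocalization)
    (h : (M : ℂ) = 2 ^ f * z) : (2 : ℤ) ^ f ∣ M := by
  obtain ⟨c, a, b, hc, hz⟩ := hz
  have h1 : (c : ℂ) * M = 2 ^ f * (a + b * Complex.I) := by rw [h, ← hz]; ring
  have h2 : c * M = 2 ^ f * a := by
    have h3 := congrArg Complex.re h1
    have h4 : ((2 : ℂ) ^ f) = ((2 ^ f : ℤ) : ℂ) := by push_cast; rfl
    rw [h4] at h3
    simp only [Complex.mul_re, Complex.add_re, Complex.intCast_re, Complex.intCast_im,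
      Complex.mul_im, Complex.add_im, Complex.I_re, Complex.I_im] at h3
    have h5 : ((c * M : ℤ) : ℝ) = ((2 ^ f * a : ℤ) : ℝ) := by push_cast at *; linarith
    exact_mod_cast h5
  have hcop : IsCoprime ((2 : ℤ) ^ f) c := by
    refine IsCoprime.pow_left ?_
    obtain ⟨k, hk⟩ := hc
    exact ⟨-k, 1, by rw [hk]; ring⟩
  exact hcop.dvd_of_dvd_mul_left ⟨a, h2⟩

/-- Polynomials all of whose coefficients lie in a subring of `ℂ`. -/
def coeffSubring (O : Subring ℂ) : Subring ℂ[X] where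
  carrier := {p | ∀ k, p.coeff k ∈ O}
  mul_mem' := by
    intro p q hp hq k
    rw [coeff_mul]
    exact O.sum_mem fun i _ => O.mul_mem (hp _) (hq _)
  one_mem' := by
    intro k
    rw [coeff_one]
    split_ifs
    exacts [O.one_mem, O.zero_mem]
  add_mem' := by
    intro p q hp hq k
    rw [coeff_add]
    exact O.add_mem (hp k) (hq k)
  zero_mem' := by
    intro k
    rw [coeff_zero]
    exact O.zero_mem
  neg_mem' := by
    intro p hp k
    rw [coeff_neg]
    exact O.neg_mem (hp k)

lemma X_mem_coeffSubring (O : Subring ℂ) : X ∈ coeffSubring O := by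
  intro k
  rw [coeff_X]
  split_ifs
  exacts [O.one_mem, O.zero_mem]

lemma C_mem_coeffSubring {O : Subring ℂ} {z : ℂ} (hz : z ∈ O) : C z ∈ coeffSubring O := by
  intro k
  rw [coeff_C]
  split_ifs
  exacts [hz, O.zero_mem]

/-- Low-order coefficients of `F` lie in `O` as soon as those of `(u - w X) ^ a * F` do, for `u` a
unit of `O` and `w ∈ O`. -/
lemma coeff_mem_of_linear_pow_mul {O : Subring ℂ} {u w : ℂ} (hu : u ≠ 0) (hu' : u⁻¹ ∈ O)
    (hw : w ∈ O) (m a : ℕ) (F : ℂ[X])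
    (h : ∀ k < m, ((C u - C w * X) ^ a * F).coeff k ∈ O) : ∀ k < m, F.coeff k ∈ O := by
  induction a generalizing F with
  | zero => simpa using h
  | succ a ih =>
    have h1 := ih ((C u - C w * X) * F) (by simpa [pow_succ, mul_assoc] using h)
    intro k
    induction k with
    | zero =>
      intro hk
      have h2 := O.mul_mem hu' (h1 0 hk)
      simpa [sub_mul, mul_assoc, hu, ← mul_assoc u⁻¹] using h2
    | succ k ihk =>
      intro hk
      have h2 := O.mul_mem hu' (O.add_mem (h1 (k + 1) hk) (O.mul_mem hw (ihk (by omega))))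
      simpa [sub_mul, mul_assoc, hu, ← mul_assoc u⁻¹] using h2

lemma onePlusI_ne_zero : (1 + Complex.I : ℂ) ≠ 0 := by
  intro h
  have := congrArg Complex.re h
  simp at this

/-- In the coordinate `v` with `x = 5 - 2(1+i)v`, the polynomial part of `R n` is
`2^(4n-2) (1+i)^(-3n-1)` times a polynomial with `2`-integral coefficients. -/
lemma polyPart_comp_coeff_mem (n k : ℕ) :
    (2 : ℂ) ^ (2 * (3 * n + 1)) * (1 + Complex.I) ^ (3 * n + 1) / 2 ^ (10 * n) *
      (((polyPart n).map (Int.castRingHom ℂ)).comp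
        (5 - C (2 * (1 + Complex.I)) * X)).coeff k ∈ oddLocalization := by
  set O := oddLocalization
  set i := Complex.I
  set w : ℂ := 1 + i with hw
  have hw0 : w ≠ 0 := onePlusI_ne_zero
  have hiO : i ∈ O := I_mem_oddLocalization
  have hwO : w ∈ O := O.add_mem O.one_mem hiO
  have h5O : (5 : ℂ)⁻¹ ∈ O := by
    have := inv_mem_oddLocalization (c := 5) (by decide)
    simpa using this
  set a := 3 * n + 1 with ha
  set T := principal n
  set P := (polyPart n).map (Int.castRingHom ℂ)
  set s : ℂ[X] := 5 - C (2 * w) * X with hs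
  set S := coeffSubring O
  have hCS : ∀ {z}, z ∈ O → C z ∈ S := fun hz => C_mem_coeffSubring hz
  have hXS : X ∈ S := X_mem_coeffSubring O
  have hii : i ^ 2 = -1 := Complex.I_sq
  set l : ℂ[X] := C 5 - C w * X with hl
  have hlS : l ∈ S := S.sub_mem (hCS (ofNat_mem O 5)) (S.mul_mem (hCS hwO) hXS)
  set y : ℂ[X] := C (1 - i) - X with hy
  have hyS : y ∈ S := S.sub_mem (hCS (O.sub_mem O.one_mem hiO)) hXS
  set G : ℂ[X] := (1 + C (2 * i) * y ^ 2) * (1 + C w * y + C i * y ^ 2) with hG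
  have hGS : G ∈ S := S.mul_mem
    (S.add_mem S.one_mem (S.mul_mem (hCS (O.mul_mem (ofNat_mem O 2) hiO)) (S.pow_mem hyS 2)))
    (S.add_mem (S.add_mem S.one_mem (S.mul_mem (hCS hwO) hyS))
      (S.mul_mem (hCS hiO) (S.pow_mem hyS 2)))
  have hsS : s ∈ S := S.sub_mem (ofNat_mem S 5)
    (S.mul_mem (hCS (O.mul_mem (ofNat_mem O 2) hwO)) hXS)
  have hCi : (C i : ℂ[X]) ^ 2 = -1 := by rw [← C_pow, hii, C_neg, C_1]
  have c2 : (C 2 : ℂ[X]) = 2 := rfl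
  have c5 : (C 5 : ℂ[X]) = 5 := rfl
  have hsG : s ^ 4 + 6 * s ^ 2 + 25 = 32 * G := by
    have hsy : s = 1 + 2 * C w * y := by
      simp only [hs, hy, hw, C_mul, C_add, C_sub, C_1, c2]
      linear_combination 2 * hCi
    have hw2 : (C w : ℂ[X]) ^ 2 = 2 * C i := by
      simp only [hw, C_add, C_1]
      linear_combination hCi
    rw [hsy, hG, C_mul, c2]
    linear_combination (32 * y ^ 2 + 32 * C w * y ^ 3 + 16 * y ^ 2 +
      16 * y ^ 4 * (C w ^ 2 + 2 * C i)) * hw2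
  set N' : ℂ[X] := 5 * s ^ (2 * n) * G ^ (2 * n) with hN'
  have hN'S : N' ∈ S := S.mul_mem (S.mul_mem (ofNat_mem S 5) (S.pow_mem hsS _))
    (S.pow_mem hGS _)
  have hNs : ((numer n).map (Int.castRingHom ℂ)).comp s = C (2 ^ (10 * n)) * N' := by
    have h32 : (32 : ℂ[X]) ^ (2 * n) = C (2 ^ (10 * n)) := by
      rw [C_pow, c2, show (32 : ℂ[X]) = 2 ^ 5 by norm_num, ← pow_mul]
      congr 1; ring
    simp only [numer, Polynomial.map_mul, Polynomial.map_pow, Polynomial.map_add,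
      Polynomial.map_ofNat, map_X, mul_comp, pow_comp, add_comp, ofNat_comp, X_comp,
      Nat.cast_ofNat]
    rw [hsG, mul_pow, h32, hN']
    ring
  have hpf := congrArg (fun f => f.comp s) (numer_partialFraction n)
  simp only [hNs, add_comp, mul_comp, pow_comp, sub_comp, ofNat_comp, X_comp, comp_assoc,
    Nat.cast_ofNat] at hpf
  have h5s : (5 : ℂ[X]) - s = C (2 * w) * X := by rw [hs]; ring
  have h5s' : (5 : ℂ[X]) + s = C 2 * l := by
    rw [hs, hl, C_mul, c2, c5]; ring
  rw [h5s, h5s'] at hpf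
  set κ : ℂ := 2 ^ a / 2 ^ (10 * n) with hκ
  set τ : ℂ[X] := C κ * T.comp (C (2 * w) * X) with hτ
  have hτc : ∀ k, τ.coeff k = κ * (2 * w) ^ k * T.coeff k := by
    intro k
    rw [hτ, coeff_C_mul, comp_C_mul_X_coeff]; ring
  set σ : ℂ[X] := C (κ * w ^ a) * T.comp (C 2 * l) with hσ
  set q : ℂ[X] := C ((2 : ℂ) ^ (2 * a) * w ^ a / 2 ^ (10 * n)) * P.comp s with hq
  have h2 : (2 : ℂ) ^ (10 * n) ≠ 0 := pow_ne_zero _ two_ne_zero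
  have hmain : N' = X ^ a * (l ^ a * q + σ) + l ^ a * τ := by
    have e1 : N' = C (1 / 2 ^ (10 * n)) * (C (2 ^ (10 * n)) * N') := by
      rw [← mul_assoc, ← C_mul, one_div, inv_mul_cancel₀ h2, C_1, one_mul]
    rw [e1, hpf, hσ, hq, hτ, hκ]
    simp only [div_eq_mul_inv, C_mul, C_pow, mul_pow, one_mul, two_mul a, pow_add]
    ring
  have hτO : τ ∈ S := by
    intro k
    by_cases hk : k < a
    · refine coeff_mem_of_linear_pow_mul (by norm_num) h5O hwO a a τ ?_ k hk
      intro j hj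
      have h3 := hN'S j
      rw [hmain, coeff_add, coeff_X_pow_mul', if_neg (by omega), zero_add] at h3
      exact h3
    · rw [hτc, coeff_eq_zero_of_degree_lt, mul_zero]
      · exact O.zero_mem
      · exact (principal_degree_lt n).trans_le (by exact_mod_cast not_lt.1 hk)
  have hσO : σ ∈ S := by
    have hT : T = ∑ k ∈ Finset.range a, C (T.coeff k) * X ^ k := by
      ext k
      simp only [finsetSum_coeff, coeff_C_mul, coeff_X_pow, mul_ite, mul_one, mul_zero]
      rw [Finset.sum_ite_eq]
      split_ifs with hk
      · rfl
      · rw [Finset.mem_range, not_lt] at hk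
        exact coeff_eq_zero_of_degree_lt ((principal_degree_lt n).trans_le (by exact_mod_cast hk))
    have hσ' : σ = ∑ k ∈ Finset.range a, C (τ.coeff k * w ^ (a - k)) * l ^ k := by
      rw [hσ]
      conv_lhs => rw [hT]
      rw [Polynomial.sum_comp, Finset.mul_sum]
      refine Finset.sum_congr rfl fun k hk => ?_
      rw [Finset.mem_range] at hk
      rw [hτc]
      have : w ^ a = w ^ k * w ^ (a - k) := by rw [← pow_add]; congr 1; omega
      rw [this]
      simp only [mul_comp, C_comp, X_pow_comp, C_mul, C_pow, mul_pow]
      ring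
    rw [hσ']
    exact S.sum_mem fun k _ => S.mul_mem (hCS (O.mul_mem (hτO k) (O.pow_mem hwO _)))
      (S.pow_mem hlS k)
  have hlq : l ^ a * q ∈ S := by
    have h3 : X ^ a * (l ^ a * q) ∈ S := by
      have : X ^ a * (l ^ a * q) = N' - l ^ a * τ - X ^ a * σ := by rw [hmain]; ring
      rw [this]
      exact S.sub_mem (S.sub_mem hN'S (S.mul_mem (S.pow_mem hlS _) hτO))
        (S.mul_mem (S.pow_mem hXS _) hσO)
    intro k
    have h4 := h3 (k + a)
    rwa [coeff_X_pow_mul] at h4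
  have := coeff_mem_of_linear_pow_mul (by norm_num) h5O hwO (k + 1) a q
    (fun j _ => hlq j) k (Nat.lt_succ_self k)
  rwa [hq, coeff_C_mul] at this

end TwoAdic

section Integral

open Polynomial

lemma integral_eval_affine (p : ℂ[X]) (M : ℕ) (hM : p.natDegree < M) (c d : ℂ) :
    ∫ t in (-1 : ℝ)..1, p.eval (c + d * t) * d =
      ∑ m ∈ Finset.range M, p.coeff m * (((c + d) ^ (m + 1) - (c - d) ^ (m + 1)) / (m + 1)) := by
  have hder : ∀ t ∈ Set.uIcc (-1 : ℝ) 1, HasDerivAt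
      (fun t : ℝ => ∑ m ∈ Finset.range M, p.coeff m * ((c + d * t) ^ (m + 1) / (m + 1)))
      (p.eval (c + d * t) * d) t := by
    intro t _
    rw [eval_eq_sum_range' hM, Finset.sum_mul]
    refine HasDerivAt.fun_sum fun m _ => ?_
    have h1 : HasDerivAt (fun t : ℝ => c + d * t) d t := by
      simpa using ((Complex.ofRealCLM.hasDerivAt (x := t)).const_mul d).const_add c
    have h2 := ((h1.fun_pow (m + 1)).div_const ((m : ℂ) + 1)).const_mul (p.coeff m)
    refine h2.congr_deriv ?_
    have : (m : ℂ) + 1 ≠ 0 := Nat.cast_add_one_ne_zero m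
    push_cast
    field_simp
  rw [intervalIntegral.integral_eq_sub_of_hasDerivAt hder, ← Finset.sum_sub_distrib]
  · refine Finset.sum_congr rfl fun m _ => ?_
    push_cast
    ring
  · refine Continuous.intervalIntegrable ?_ _ _
    exact (p.continuous.comp (by fun_prop)).mul continuous_const

lemma polyPart_natDegree_lt (n : ℕ) (hn : 1 ≤ n) : (polyPart n).natDegree < 4 * n := by
  have h1 : (numer n).natDegree ≤ 10 * n := by
    have h2 : (X ^ 4 + 6 * X ^ 2 + 25 : ℤ[X]).natDegree ≤ 4 := by compute_degree
    calc (numer n).natDegree ≤ 0 + 2 * n + 2 * n * 4 :=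
          natDegree_mul_le_of_le (natDegree_mul_le_of_le (natDegree_ofNat 5).le
            (natDegree_X_pow_le _)) (natDegree_pow_le_of_le _ h2)
      _ = 10 * n := by ring
  have h3 : ((X ^ 2 - C 25 : ℤ[X]) ^ (3 * n + 1)).natDegree = (3 * n + 1) * 2 := by
    rw [(monic_X_pow_sub_C (25 : ℤ) two_ne_zero).natDegree_pow, natDegree_X_pow_sub_C]
  refine (natDegree_C_mul_le _ _).trans_lt ?_
  rw [natDegree_divByMonic _ (monic_X_sq_sub ℤ 25 _), h3]
  omega

lemma Phi_mul_L (n : ℕ) : Phi n * L n = lcmUpTo (4 * n) := by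
  refine Nat.mul_div_cancel' ?_
  refine Finset.prod_primes_dvd _ (fun p hp => (Finset.mem_filter.1 hp).2.prime.prime)
    fun p hp => ?_
  obtain ⟨hp1, hp2⟩ := Finset.mem_filter.1 hp
  rw [Finset.mem_range] at hp1
  exact Finset.dvd_lcm (f := id) (Finset.mem_Icc.2 ⟨hp2.prime.pos, by omega⟩)

lemma odd_Phi (n : ℕ) : Odd (Phi n) :=
  Finset.prod_induction _ Odd (fun _ _ h h' => h.mul h') odd_one
    fun _ hp => (Finset.mem_filter.1 hp).2.odd

lemma lcmUpTo_ne_zero (m : ℕ) : lcmUpTo m ≠ 0 := by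
  rw [lcmUpTo, Ne, Finset.lcm_eq_zero_iff]
  simp

lemma dvd_lcmUpTo {k m : ℕ} (hk : 1 ≤ k) (hkm : k ≤ m) : k ∣ lcmUpTo m :=
  Finset.dvd_lcm (f := id) (Finset.mem_Icc.2 ⟨hk, hkm⟩)

lemma succ_dvd_L_mul_coeff (n m : ℕ) (hm : m < 4 * n) :
    ((m + 1 : ℕ) : ℤ) ∣ L n * (polyPart n).coeff m := by
  obtain ⟨c, hc⟩ := dvd_lcmUpTo (show 1 ≤ m + 1 by omega) (show m + 1 ≤ 4 * n by omega)
  have h1 : (Phi n : ℤ) ∣ c * (polyPart n).coeff m := by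
    rw [← Int.natAbs_dvd_natAbs, Int.natAbs_natCast]
    refine Finset.prod_primes_dvd _ (fun p hp => (Finset.mem_filter.1 hp).2.prime.prime)
      fun p hp => ?_
    obtain ⟨hp1, hp2⟩ := Finset.mem_filter.1 hp
    rw [Finset.mem_range] at hp1
    rw [← Int.natCast_dvd]
    by_cases hpm : p ∣ m + 1
    · exact (dvd_polyPart_coeff hp2 hpm).mul_left _
    · have h3 := dvd_lcmUpTo hp2.prime.pos (show p ≤ 4 * n by omega)
      rw [hc] at h3
      have h4 := (hp2.prime.dvd_mul.1 h3).resolve_left hpm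
      exact (Int.natCast_dvd_natCast.2 h4).mul_right _
  obtain ⟨t, ht⟩ := h1
  refine ⟨t, ?_⟩
  have h0 : (Phi n : ℤ) ≠ 0 := by exact_mod_cast (odd_Phi n).pos.ne'
  refine mul_left_cancel₀ h0 ?_
  have h2 : (Phi n : ℤ) * L n = (m + 1 : ℕ) * c := by
    rw [← Nat.cast_mul, ← Nat.cast_mul, Phi_mul_L, hc]
  linear_combination (polyPart n).coeff m * h2 + ((m + 1 : ℕ) : ℤ) * ht

lemma exists_int_I_mul_pow_sub_pow (k : ℕ) :
    ∃ r : ℤ, Complex.I * ((-1 + 2 * Complex.I) ^ k - (-1 - 2 * Complex.I) ^ k) = r := by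
  have h : ∃ x y : ℤ, (-1 + 2 * Complex.I) ^ k = x + y * Complex.I ∧
      (-1 - 2 * Complex.I) ^ k = x - y * Complex.I := by
    induction k with
    | zero => exact ⟨1, 0, by simp, by simp⟩
    | succ k ih =>
      obtain ⟨x, y, h1, h2⟩ := ih
      refine ⟨-x - 2 * y, 2 * x - y, ?_, ?_⟩
      · rw [pow_succ, h1]; push_cast
        linear_combination 2 * (y : ℂ) * Complex.I_sq
      · rw [pow_succ, h2]; push_cast
        linear_combination 2 * (y : ℂ) * Complex.I_sq
  obtain ⟨x, y, h1, h2⟩ := h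
  refine ⟨-2 * y, ?_⟩
  rw [h1, h2]
  push_cast
  linear_combination 2 * (y : ℂ) * Complex.I_sq

lemma exists_mul_pow_sub_pow_div_eq_two_mul {Λ k : ℕ} (hk : 1 ≤ k) (hΛ : k ∣ Λ) (h2 : 2 ∣ Λ) :
    ∃ e ∈ oddLocalization,
      (Λ : ℂ) * (((1 - 2 * Complex.I) ^ k - (2 - Complex.I) ^ k) / k) = 2 * e := by
  set O := oddLocalization
  have hI : Complex.I ∈ O := I_mem_oddLocalization
  have h2O : (2 : ℂ) ∈ O := ofNat_mem O 2
  have hu : (1 - 2 * Complex.I) ∈ O := O.sub_mem O.one_mem (O.mul_mem h2O hI)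
  have hv : (2 - Complex.I) ∈ O := O.sub_mem h2O hI
  have hk0 : (k : ℂ) ≠ 0 := by exact_mod_cast (by omega : k ≠ 0)
  obtain ⟨c, rfl⟩ := hΛ
  rcases Nat.even_or_odd' k with ⟨j, rfl | rfl⟩
  · refine ⟨c * (-3 * ∑ i ∈ Finset.range j,
      ((1 - 2 * Complex.I) ^ 2) ^ i * ((2 - Complex.I) ^ 2) ^ (j - 1 - i)), ?_, ?_⟩
    · exact O.mul_mem (natCast_mem O c) (O.mul_mem (O.neg_mem (ofNat_mem O 3))
        (O.sum_mem fun i _ => O.mul_mem (O.pow_mem (O.pow_mem hu _) _)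
          (O.pow_mem (O.pow_mem hv _) _)))
    · have h := geom_sum₂_mul ((1 - 2 * Complex.I) ^ 2) ((2 - Complex.I) ^ 2) j
      have h6 : (1 - 2 * Complex.I) ^ 2 - (2 - Complex.I) ^ 2 = -6 := by
        linear_combination 3 * Complex.I_sq
      rw [h6] at h
      rw [pow_mul, pow_mul, ← h, Nat.cast_mul _ c]
      field_simp
      ring
  · have hc : 2 ∣ c := by
      rw [Nat.Prime.dvd_mul Nat.prime_two] at h2
      rcases h2 with h | h
      · omega
      · exact h
    obtain ⟨d, rfl⟩ := hc
    refine ⟨d * ((1 - 2 * Complex.I) ^ (2 * j + 1) - (2 - Complex.I) ^ (2 * j + 1)),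
      O.mul_mem (natCast_mem O d) (O.sub_mem (O.pow_mem hu _) (O.pow_mem hv _)), ?_⟩
    rw [Nat.cast_mul, Nat.cast_mul 2 d]
    field_simp
    push_cast
    ring

end Integral

/-- **Lemma 5.** The number `i ∫_{-1-2i}^{-1+2i} P_n(x) dx` (integral along the straight
segment, parametrized by `x = -1 + 2it`, `t ∈ [-1,1]`) is rational, and
`2^{-⌊5n/2⌋} L_n · (i ∫ P_n)` is an integer. -/
theorem Lemma5 (n : ℕ) (hn : 1 ≤ n) :
    (∃ q : ℚ, Complex.I *
        (∫ t in (-1 : ℝ)..1, Ppart n (-1 + 2 * Complex.I * t) * (2 * Complex.I)) = (q : ℂ)) ∧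
      ∃ m : ℤ, (2 : ℂ) ^ (-((5 * n / 2 : ℕ) : ℤ)) * (L n : ℂ) *
        (Complex.I *
          (∫ t in (-1 : ℝ)..1, Ppart n (-1 + 2 * Complex.I * t) * (2 * Complex.I))) = (m : ℂ) := by
  generalize hJ : Complex.I *
    (∫ t in (-1 : ℝ)..1, Ppart n (-1 + 2 * Complex.I * t) * (2 * Complex.I)) = J
  set O := oddLocalization
  have hI : Complex.I ∈ O := I_mem_oddLocalization
  set P := (polyPart n).map (Int.castRingHom ℂ) with hP
  have hPdeg : P.natDegree < 4 * n :=
    Polynomial.natDegree_map_le.trans_lt (polyPart_natDegree_lt n hn)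
  have hPpart : ∀ t : ℝ, Ppart n (-1 + 2 * Complex.I * t) = P.eval (-1 + 2 * Complex.I * t) := by
    intro t
    refine Ppart_eq_eval n _ ?_ ?_
    · intro h
      have := congrArg Complex.re h
      simp at this
      norm_num at this
    · intro h
      have := congrArg Complex.re h
      simp at this
      norm_num at this
  have hJP : J = Complex.I *
      (∫ t in (-1 : ℝ)..1, P.eval (-1 + 2 * Complex.I * t) * (2 * Complex.I)) := by
    simp only [← hJ, hPpart]
  have hL0 : (L n : ℂ) ≠ 0 := by
    intro h
    rw [Nat.cast_eq_zero] at h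
    have := Phi_mul_L n
    rw [h, mul_zero] at this
    exact lcmUpTo_ne_zero _ this.symm
  obtain ⟨M, hM⟩ : ∃ M : ℤ, (L n : ℂ) * J = M := by
    choose r hr using exists_int_I_mul_pow_sub_pow
    have hterm : ∀ m ∈ Finset.range (4 * n), ∃ t : ℤ, (L n : ℂ) * (Complex.I * (P.coeff m *
        (((-1 + 2 * Complex.I) ^ (m + 1) - (-1 - 2 * Complex.I) ^ (m + 1)) / (m + 1)))) = t := by
      intro m hm
      obtain ⟨t, ht⟩ := succ_dvd_L_mul_coeff n m (Finset.mem_range.1 hm)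
      refine ⟨t * r (m + 1), ?_⟩
      have ht' : (L n : ℂ) * P.coeff m = (m + 1) * t := by
        rw [hP, Polynomial.coeff_map, eq_intCast]
        exact_mod_cast congrArg (Int.cast : ℤ → ℂ) ht
      have hm0 : (m : ℂ) + 1 ≠ 0 := Nat.cast_add_one_ne_zero m
      rw [Int.cast_mul, ← hr (m + 1)]
      calc _ = ((L n : ℂ) * P.coeff m) * (Complex.I * ((-1 + 2 * Complex.I) ^ (m + 1) -
            (-1 - 2 * Complex.I) ^ (m + 1))) / (m + 1) := by ring
        _ = _ := by rw [ht']; field_simp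
    choose! t ht using hterm
    refine ⟨∑ m ∈ Finset.range (4 * n), t m, ?_⟩
    rw [hJP, integral_eval_affine P _ hPdeg, Finset.mul_sum, Finset.mul_sum, Int.cast_sum]
    exact Finset.sum_congr rfl ht
  refine ⟨⟨M / L n, ?_⟩, ?_⟩
  · push_cast
    rw [← hM]
    field_simp
  set w : ℂ := 1 + Complex.I with hw
  have hw0 : w ≠ 0 := onePlusI_ne_zero
  set s : Polynomial ℂ := 5 - Polynomial.C (2 * w) * Polynomial.X with hs
  have hsdeg : (P.comp s).natDegree < 4 * n := by
    refine lt_of_le_of_lt ?_ hPdeg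
    have : s.natDegree ≤ 1 := by rw [hs]; compute_degree
    exact Polynomial.natDegree_comp_le.trans (by nlinarith)
  have hJv : J = Complex.I * (-(2 * w)) * ∑ m ∈ Finset.range (4 * n), (P.comp s).coeff m *
      (((1 - 2 * Complex.I) ^ (m + 1) - (2 - Complex.I) ^ (m + 1)) / (m + 1)) := by
    have h1 := integral_eval_affine (P.comp s) _ hsdeg (3 / w) (-Complex.I / w)
    have hcd : 3 / w + -Complex.I / w = 1 - 2 * Complex.I := by
      field_simp
      rw [hw]
      linear_combination 2 * Complex.I_sq
    have hcd' : 3 / w - -Complex.I / w = 2 - Complex.I := by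
      field_simp
      rw [hw]
      linear_combination Complex.I_sq
    rw [hcd, hcd'] at h1
    rw [← h1, hJP, mul_assoc, ← intervalIntegral.integral_const_mul (-(2 * w))]
    congr 1
    refine intervalIntegral.integral_congr fun t _ => ?_
    have h2 : s.eval (3 / w + -Complex.I / w * t) = -1 + 2 * Complex.I * t := by
      simp only [hs, Polynomial.eval_sub, Polynomial.eval_mul, Polynomial.eval_C,
        Polynomial.eval_X, Polynomial.eval_ofNat]
      field_simp
      ring
    simp only [Polynomial.eval_comp, h2]
    field_simp
  set κ : ℂ := (2 : ℂ) ^ (2 * (3 * n + 1)) * w ^ (3 * n + 1) / 2 ^ (10 * n) with hκ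
  have hq : ∀ m, κ * (P.comp s).coeff m ∈ O := fun m => polyPart_comp_coeff_mem n m
  have hΛ2 : 2 ∣ lcmUpTo (4 * n) := dvd_lcmUpTo (by omega) (by omega)
  have hbr : ∀ m ∈ Finset.range (4 * n), ∃ e ∈ O, (lcmUpTo (4 * n) : ℂ) *
      (((1 - 2 * Complex.I) ^ (m + 1) - (2 - Complex.I) ^ (m + 1)) / (m + 1)) = 2 * e := by
    intro m hm
    rw [Finset.mem_range] at hm
    have := exists_mul_pow_sub_pow_div_eq_two_mul (show 1 ≤ m + 1 by omega)
      (dvd_lcmUpTo (show 1 ≤ m + 1 by omega) (show m + 1 ≤ 4 * n by omega)) hΛ2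
    simpa using this
  choose! e heO he using hbr
  set E := ∑ m ∈ Finset.range (4 * n), (κ * (P.comp s).coeff m) * e m with hE
  have hEO : E ∈ O := O.sum_mem fun m hm => O.mul_mem (hq m) (heO m hm)
  have hΛJ : κ * ((lcmUpTo (4 * n) : ℂ) * J) = -(Complex.I * (4 * w)) * E := by
    have : κ * ((lcmUpTo (4 * n) : ℂ) * J) = Complex.I * (-(2 * w)) *
        ∑ m ∈ Finset.range (4 * n), (κ * (P.comp s).coeff m) * ((lcmUpTo (4 * n) : ℂ) *
          (((1 - 2 * Complex.I) ^ (m + 1) - (2 - Complex.I) ^ (m + 1)) / (m + 1))) := by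
      rw [hJv, Finset.mul_sum, Finset.mul_sum, Finset.mul_sum, Finset.mul_sum]
      exact Finset.sum_congr rfl fun m _ => by ring
    rw [this, hE, Finset.mul_sum, Finset.mul_sum]
    refine Finset.sum_congr rfl fun m hm => ?_
    rw [he m hm]
    ring
  set f := 5 * n / 2 with hf
  set w' : ℂ := 1 - Complex.I with hw'
  have hww' : w * w' = 2 := by
    rw [hw, hw']
    linear_combination -Complex.I_sq
  obtain ⟨g, hg⟩ : ∃ g, f = n + g := ⟨f - n, by omega⟩
  obtain ⟨h, hh⟩ : ∃ h, 3 * n = 2 * g + h := ⟨3 * n - 2 * g, by omega⟩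
  have hκ' : κ * (2 ^ f * ((-Complex.I) ^ g * w' ^ h)) = 4 * w := by
    have h1 : (2 : ℂ) ^ f * ((-Complex.I) ^ g * w' ^ h) = 2 ^ n * w' ^ (3 * n) := by
      have h2 : w' ^ 2 = 2 * -Complex.I := by
        rw [hw']
        linear_combination Complex.I_sq
      rw [hh, pow_add w', pow_mul, h2, hg, pow_add, mul_pow]
      ring
    have h3 : w ^ (3 * n + 1) * w' ^ (3 * n) = 2 ^ (3 * n) * w := by
      rw [← hww', mul_pow, pow_succ]
      ring
    have h4 : (2 : ℂ) ^ (2 * (3 * n + 1)) * 2 ^ n * 2 ^ (3 * n) = 4 * 2 ^ (10 * n) := by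
      rw [← pow_add, ← pow_add, show 2 * (3 * n + 1) + n + 3 * n = 10 * n + 2 by ring, pow_add]
      ring
    have h5 : (2 : ℂ) ^ (10 * n) ≠ 0 := pow_ne_zero _ two_ne_zero
    rw [h1, hκ, div_mul_eq_mul_div, div_eq_iff h5]
    linear_combination (2 : ℂ) ^ (2 * (3 * n + 1)) * 2 ^ n * h3 + w * h4
  have hκ0 : κ ≠ 0 := by
    intro h0
    rw [h0, zero_mul] at hκ'
    exact mul_ne_zero (by norm_num) hw0 hκ'.symm
  have hΛJ' : (lcmUpTo (4 * n) : ℂ) * J =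
      2 ^ f * (((-Complex.I) ^ g * w' ^ h) * (-Complex.I * E)) := by
    refine mul_left_cancel₀ hκ0 ?_
    rw [hΛJ]
    linear_combination Complex.I * E * hκ'
  have hPhi0 : ((Phi n : ℤ) : ℂ) ≠ 0 := by exact_mod_cast (odd_Phi n).pos.ne'
  have hdvd : (2 : ℤ) ^ f ∣ M := by
    refine two_pow_dvd_of_eq_mul (z := (((Phi n : ℤ) : ℂ)⁻¹ *
      (((-Complex.I) ^ g * w' ^ h) * (-Complex.I * E)))) ?_ ?_
    · exact O.mul_mem (inv_mem_oddLocalization (by exact_mod_cast odd_Phi n))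
        (O.mul_mem (O.mul_mem (O.pow_mem (O.neg_mem hI) _)
          (O.pow_mem (O.sub_mem O.one_mem hI) _)) (O.mul_mem (O.neg_mem hI) hEO))
    · rw [← hM, mul_left_comm, ← hΛJ', ← Phi_mul_L]
      push_cast at hPhi0 ⊢
      field_simp
  obtain ⟨m, hm⟩ := hdvd
  refine ⟨m, ?_⟩
  have h2 : (2 : ℂ) ^ f ≠ 0 := pow_ne_zero _ two_ne_zero
  rw [mul_assoc, hM, hm, zpow_neg, zpow_natCast]
  push_cast
  field_simp
end
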